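/- arXiv:1707.00473 — 3 statements merged into one kernel-verified Lean document; each statement's English description precedes it below -/
import Mathlib

section
/- Let the pressure be p(ρ) = ρ^γ with γ ≥ 1. Let ρ₋, ρ₊ > 0 and v₋, v₊ ∈ ℝ² satisfy v₋₂ − v₊₂ > √((ρ₊ − ρ₋)(p(ρ₊) − p(ρ₋))/(ρ₊ρ₋)). Then there exists an admissible fan subsolution (ρ̄, v̄, ū) of the 2D isentropic Euler system with the Riemann initial data determined by (ρ₋, v₋) and (ρ₊, v₊); moreover it can be chosen so that, writing v_i = (α_i, β_i) for its values on the middle regions P₁, P₂, one has α₁ = v₋₁, α₂ = v₊₁, ρ₁ = ρ₂, β₁ = β₂ = ν₁, and C₁ − v₋₁² = C₂ − v₊₁². -/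
open MeasureTheory Matrix

noncomputable section

/-- Space-time point: `(x, t)` with `x ∈ ℝ²` (spatial variable) and `t ∈ ℝ` (time). -/
abbrev SpaceTime : Type := (Fin 2 → ℝ) × ℝ

/-- A test function: smooth and compactly supported on `ℝ² × ℝ`. -/
def IsTest (φ : SpaceTime → ℝ) : Prop :=
  ContDiff ℝ (⊤ : ℕ∞) φ ∧ HasCompactSupport φ

/-- Time partial derivative `∂_t φ`. -/
def pdt (φ : SpaceTime → ℝ) (q : SpaceTime) : ℝ := fderiv ℝ φ q (0, 1)

/-- Spatial partial derivative `∂_{x_i} φ`. -/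
def pdx (i : Fin 2) (φ : SpaceTime → ℝ) (q : SpaceTime) : ℝ :=
  fderiv ℝ φ q (Pi.single i 1, 0)

/-- The set of space-time points with positive time, i.e. `ℝ² × (0,∞)`. -/
def posTime : Set SpaceTime := {q | 0 < q.2}

/-- Riemann initial data for the density. -/
def riemannRho (ρm ρp : ℝ) (x : Fin 2 → ℝ) : ℝ := if x 1 < 0 then ρm else ρp

/-- Riemann initial data for the velocity. -/
def riemannV (vm vp : Fin 2 → ℝ) (x : Fin 2 → ℝ) : Fin 2 → ℝ :=
  if x 1 < 0 then vm else vp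

/-- Squared euclidean norm `|v|²` of a vector `v ∈ ℝ²`. -/
def sq2 (v : Fin 2 → ℝ) : ℝ := ∑ i, v i ^ 2

/-- `(ρ, v)` is a weak solution (in the sense of distributions, with the initial data
`(ρ0, v0)` entering through the `t = 0` boundary term) of the compressible isentropic
Euler system `∂_t ρ + div_x (ρ v) = 0`, `∂_t (ρ v) + div_x (ρ v ⊗ v) + ∇_x p(ρ) = 0`
on `ℝ² × (0,∞)`, with pressure law `p`. -/
def IsWeakSolution (p : ℝ → ℝ) (ρ0 : (Fin 2 → ℝ) → ℝ) (v0 : (Fin 2 → ℝ) → Fin 2 → ℝ)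
    (ρ : SpaceTime → ℝ) (v : SpaceTime → Fin 2 → ℝ) : Prop :=
  (∀ φ : SpaceTime → ℝ, IsTest φ →
    (∫ q in posTime, (ρ q * pdt φ q + ∑ i, ρ q * v q i * pdx i φ q))
      + (∫ x, ρ0 x * φ (x, 0)) = 0) ∧
  (∀ j : Fin 2, ∀ φ : SpaceTime → ℝ, IsTest φ →
    (∫ q in posTime,
        (ρ q * v q j * pdt φ q + (∑ i, ρ q * v q j * v q i * pdx i φ q)
          + p (ρ q) * pdx j φ q))
      + (∫ x, ρ0 x * v0 x j * φ (x, 0)) = 0)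

/-- `(ρ, v)` satisfies the weak form of the entropy (energy) inequality with pressure `p`,
internal energy `ε`, and initial data `(ρ0, v0)`: for every nonnegative test function `φ`,
`∫∫ [(ρε(ρ)+ρ|v|²/2) ∂_t φ + (ρε(ρ)+ρ|v|²/2+p(ρ)) v · ∇_x φ] + ∫ (ρ⁰ε(ρ⁰)+ρ⁰|v⁰|²/2) φ(·,0) ≥ 0`. -/
def IsAdmissibleSolution (p ε : ℝ → ℝ) (ρ0 : (Fin 2 → ℝ) → ℝ)
    (v0 : (Fin 2 → ℝ) → Fin 2 → ℝ)
    (ρ : SpaceTime → ℝ) (v : SpaceTime → Fin 2 → ℝ) : Prop :=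
  ∀ φ : SpaceTime → ℝ, IsTest φ → (∀ q, 0 ≤ φ q) →
    0 ≤ (∫ q in posTime,
          ((ρ q * ε (ρ q) + ρ q * sq2 (v q) / 2) * pdt φ q
            + ∑ i, (ρ q * ε (ρ q) + ρ q * sq2 (v q) / 2 + p (ρ q)) * v q i * pdx i φ q))
        + (∫ x, (ρ0 x * ε (ρ0 x) + ρ0 x * sq2 (v0 x) / 2) * φ (x, 0))

/-- Internal energy density associated with the pressure law `p(ρ) = ρ^γ` via
`p(r) = r² ε'(r)`: `ε(ρ) = ρ^(γ-1)/(γ-1)` for `γ > 1` and `ε(ρ) = log ρ` for `γ = 1`. -/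
def intEnergy (γ : ℝ) (r : ℝ) : ℝ :=
  if γ = 1 then Real.log r else r ^ (γ - 1) / (γ - 1)

/-- The pressure law `p(ρ) = ρ^γ`. -/
def pressure (γ : ℝ) (r : ℝ) : ℝ := r ^ γ

/-- `(ρ, v)` is a bounded admissible weak solution of the 2D isentropic Euler system
with pressure `p`, internal energy `ε`, and initial data `(ρ0, v0)`: it is measurable,
takes values in `(0,∞) × ℝ²`, is (essentially) bounded, is a weak solution, and
satisfies the weak energy inequality. -/
def IsBddAdmissibleSolutionGen (p ε : ℝ → ℝ) (ρ0 : (Fin 2 → ℝ) → ℝ)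
    (v0 : (Fin 2 → ℝ) → Fin 2 → ℝ)
    (ρ : SpaceTime → ℝ) (v : SpaceTime → Fin 2 → ℝ) : Prop :=
  Measurable ρ ∧ Measurable v ∧ (∀ q, 0 < ρ q) ∧
  (∃ M : ℝ, ∀ q, ρ q ≤ M ∧ ∀ i, |v q i| ≤ M) ∧
  IsWeakSolution p ρ0 v0 ρ v ∧ IsAdmissibleSolution p ε ρ0 v0 ρ v

/-- `(ρ, v)` is a bounded admissible weak solution of the 2D isentropic Euler system with
pressure `p(ρ) = ρ^γ` and Riemann initial data given by `(ρm, vm)` for `x₂ < 0` and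
`(ρp, vp)` for `x₂ > 0`. -/
def IsBddAdmissibleRiemannSolution (γ ρm ρp : ℝ) (vm vp : Fin 2 → ℝ)
    (ρ : SpaceTime → ℝ) (v : SpaceTime → Fin 2 → ℝ) : Prop :=
  IsBddAdmissibleSolutionGen (pressure γ) (intEnergy γ)
    (riemannRho ρm ρp) (riemannV vm vp) ρ v

/-- A matrix in `𝒮₀^{2×2}`: symmetric and trace-free. -/
def IsS0 (u : Matrix (Fin 2) (Fin 2) ℝ) : Prop := u.IsSymm ∧ u.trace = 0

/-- The outer product `v ⊗ v` of a vector `v ∈ ℝ²`. -/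
def outer (v : Fin 2 → ℝ) : Matrix (Fin 2) (Fin 2) ℝ := vecMulVec v v

/-- The traceless part `v ⊗ v − ½|v|² Id` used for the states `u₋, u₊`. -/
def uPM (v : Fin 2 → ℝ) : Matrix (Fin 2) (Fin 2) ℝ :=
  outer v - (sq2 v / 2) • (1 : Matrix (Fin 2) (Fin 2) ℝ)

/-- The piecewise constant field on the fan partition determined by `ν₋ < ν₁ < ν₊`,
taking values `am, a1, a2, ap` on `P₋, P₁, P₂, P₊` respectively. -/
def fanField {α : Type} (νm ν1 νp : ℝ) (am a1 a2 ap : α) (q : SpaceTime) : α :=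
  if q.1 1 < νm * q.2 then am else if q.1 1 < ν1 * q.2 then a1
  else if q.1 1 < νp * q.2 then a2 else ap

/-- The region `P₁ = {(x,t) : t > 0, ν₋ t < x₂ < ν₁ t}` of a fan partition. -/
def fanP1 (νm ν1 : ℝ) : Set SpaceTime :=
  {q | 0 < q.2 ∧ νm * q.2 < q.1 1 ∧ q.1 1 < ν1 * q.2}

/-- The region `P₂ = {(x,t) : t > 0, ν₁ t < x₂ < ν₊ t}` of a fan partition. -/
def fanP2 (ν1 νp : ℝ) : Set SpaceTime :=
  {q | 0 < q.2 ∧ ν1 * q.2 < q.1 1 ∧ q.1 1 < νp * q.2}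

/-- Fan subsolution to the 2D isentropic compressible Euler system with pressure law `p`
and Riemann initial data `(ρm, vm)`, `(ρp, vp)`, built from the fan partition determined
by `ν₋ < ν₁ < ν₊`, middle states `(ρ₁, v₁, u₁)`, `(ρ₂, v₂, u₂)` and constants `C₁, C₂`:
the subsolution conditions `(Cᵢ/2)Id − vᵢ⊗vᵢ + uᵢ > 0` hold, and the relaxed continuity
and momentum equations hold in the sense of distributions (with the Riemann initial data
in the `t = 0` boundary terms). -/
def IsFanSubsolution (p : ℝ → ℝ) (ρm ρp : ℝ) (vm vp : Fin 2 → ℝ)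
    (νm ν1 νp ρ1 ρ2 : ℝ) (v1 v2 : Fin 2 → ℝ) (u1 u2 : Matrix (Fin 2) (Fin 2) ℝ)
    (C1 C2 : ℝ) : Prop :=
  νm < ν1 ∧ ν1 < νp ∧ 0 < ρ1 ∧ 0 < ρ2 ∧ IsS0 u1 ∧ IsS0 u2 ∧ 0 < C1 ∧ 0 < C2 ∧
  ((C1 / 2) • (1 : Matrix (Fin 2) (Fin 2) ℝ) - outer v1 + u1).PosDef ∧
  ((C2 / 2) • (1 : Matrix (Fin 2) (Fin 2) ℝ) - outer v2 + u2).PosDef ∧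
  -- continuity equation ∂_t ρ̄ + div_x (ρ̄ v̄) = 0
  (∀ φ : SpaceTime → ℝ, IsTest φ →
    (∫ q in posTime,
        (fanField νm ν1 νp ρm ρ1 ρ2 ρp q * pdt φ q
          + ∑ i, fanField νm ν1 νp (ρm * vm i) (ρ1 * v1 i) (ρ2 * v2 i) (ρp * vp i) q
              * pdx i φ q))
      + (∫ x, riemannRho ρm ρp x * φ (x, 0)) = 0) ∧
  -- momentum equation ∂_t(ρ̄ v̄) + div_x(ρ̄ ū) + ∇_x(p(ρ̄) + ½(ρ̄|v̄|²𝟙_{P₊∪P₋} + Σ Cᵢρᵢ𝟙_{Pᵢ})) = 0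
  (∀ j : Fin 2, ∀ φ : SpaceTime → ℝ, IsTest φ →
    (∫ q in posTime,
        (fanField νm ν1 νp (ρm * vm j) (ρ1 * v1 j) (ρ2 * v2 j) (ρp * vp j) q * pdt φ q
          + (∑ i, fanField νm ν1 νp (ρm * uPM vm j i) (ρ1 * u1 j i) (ρ2 * u2 j i)
                (ρp * uPM vp j i) q * pdx i φ q)
          + fanField νm ν1 νp (p ρm + ρm * sq2 vm / 2) (p ρ1 + C1 * ρ1 / 2)
              (p ρ2 + C2 * ρ2 / 2) (p ρp + ρp * sq2 vp / 2) q * pdx j φ q))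
      + (∫ x, riemannRho ρm ρp x * riemannV vm vp x j * φ (x, 0)) = 0)

/-- The total energy density of a fan subsolution:
`ρ̄ε(ρ̄) + ρ̄|v̄|²/2` on `P₋ ∪ P₊` and `ρᵢε(ρᵢ) + ρᵢCᵢ/2` on `Pᵢ`. -/
def fanEnergy (ε : ℝ → ℝ) (ρm ρp : ℝ) (vm vp : Fin 2 → ℝ)
    (νm ν1 νp ρ1 ρ2 C1 C2 : ℝ) (q : SpaceTime) : ℝ :=
  fanField νm ν1 νp (ρm * ε ρm + ρm * sq2 vm / 2) (ρ1 * ε ρ1 + ρ1 * C1 / 2)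
    (ρ2 * ε ρ2 + ρ2 * C2 / 2) (ρp * ε ρp + ρp * sq2 vp / 2) q

/-- Admissible fan subsolution: a fan subsolution which moreover satisfies the relaxed
energy inequality in the sense of distributions on `ℝ² × (0,∞)`. -/
def IsAdmissibleFanSubsolution (p ε : ℝ → ℝ) (ρm ρp : ℝ) (vm vp : Fin 2 → ℝ)
    (νm ν1 νp ρ1 ρ2 : ℝ) (v1 v2 : Fin 2 → ℝ) (u1 u2 : Matrix (Fin 2) (Fin 2) ℝ)
    (C1 C2 : ℝ) : Prop :=
  IsFanSubsolution p ρm ρp vm vp νm ν1 νp ρ1 ρ2 v1 v2 u1 u2 C1 C2 ∧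
  (∀ φ : SpaceTime → ℝ, IsTest φ → (∀ q, 0 ≤ φ q) → tsupport φ ⊆ posTime →
    0 ≤ ∫ q in posTime,
        (fanEnergy ε ρm ρp vm vp νm ν1 νp ρ1 ρ2 C1 C2 q * pdt φ q
          + ∑ i, (fanEnergy ε ρm ρp vm vp νm ν1 νp ρ1 ρ2 C1 C2 q
                + fanField νm ν1 νp (p ρm) (p ρ1) (p ρ2) (p ρp) q)
              * fanField νm ν1 νp (vm i) (v1 i) (v2 i) (vp i) q * pdx i φ q))

open Set Filter Topology

section LineDerivatives

variable {E : Type*} [NormedAddCommGroup E] [NormedSpace ℝ E] {g : E → ℝ}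

lemma contDiff_along_line (hg : ContDiff ℝ 1 g) (p v : E) :
    ContDiff ℝ 1 fun s : ℝ => g (p + s • v) := by
  fun_prop

lemma hasCompactSupport_along_line (hg : HasCompactSupport g) (p : E) {v : E} (hv : v ≠ 0) :
    HasCompactSupport fun s : ℝ => g (p + s • v) :=
  hg.comp_isClosedEmbedding
    ((Homeomorph.addLeft p).isClosedEmbedding.comp (isClosedEmbedding_smul_left hv))

lemma deriv_along_line (hg : ContDiff ℝ 1 g) (p v : E) (s : ℝ) :
    deriv (fun s : ℝ => g (p + s • v)) s = fderiv ℝ g (p + s • v) v := by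
  have h1 : HasDerivAt (fun s : ℝ => p + s • v) v s := by
    simpa using ((hasDerivAt_id s).smul_const v).const_add p
  exact ((hg.differentiable one_ne_zero _).hasFDerivAt.comp_hasDerivAt s h1).deriv

lemma integral_fderiv_line (hg : ContDiff ℝ 1 g) (h2g : HasCompactSupport g) (p : E) {v : E}
    (hv : v ≠ 0) : ∫ s : ℝ, fderiv ℝ g (p + s • v) v = 0 := by
  have hc := contDiff_along_line hg p v
  have hs := hasCompactSupport_along_line h2g p hv
  simp_rw [← deriv_along_line hg]
  exact integral_eq_zero_of_hasDerivAt_of_integrable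
    (fun s => (hc.differentiable one_ne_zero s).hasDerivAt)
    ((hc.continuous_deriv le_rfl).integrable_of_hasCompactSupport hs.deriv)
    (hc.continuous.integrable_of_hasCompactSupport hs)

lemma integral_fderiv_line_Iio (hg : ContDiff ℝ 1 g) (h2g : HasCompactSupport g) (p : E) {v : E}
    (hv : v ≠ 0) : ∫ s in Iio (0 : ℝ), fderiv ℝ g (p + s • v) v = g p := by
  simp_rw [← deriv_along_line hg]
  rw [← integral_Iic_eq_integral_Iio, HasCompactSupport.integral_Iic_deriv_eq
    (contDiff_along_line hg p v) (hasCompactSupport_along_line h2g p hv)]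
  simp

lemma integral_fderiv_line_Ioi (hg : ContDiff ℝ 1 g) (h2g : HasCompactSupport g) (p : E) {v : E}
    (hv : v ≠ 0) : ∫ s in Ioi (0 : ℝ), fderiv ℝ g (p + s • v) v = - g p := by
  simp_rw [← deriv_along_line hg]
  rw [HasCompactSupport.integral_Ioi_deriv_eq
    (contDiff_along_line hg p v) (hasCompactSupport_along_line h2g p hv)]
  simp

end LineDerivatives

section PlaneIntegrals

variable {g : (Fin 2 → ℝ) → ℝ}

lemma setIntegral_preimage_coord_one {F : (Fin 2 → ℝ) → ℝ} (hF : Integrable F) (s : Set ℝ) :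
    ∫ x in {x : Fin 2 → ℝ | x 1 ∈ s}, F x = ∫ a : ℝ, ∫ b in s, F ![a, b] := by
  have hmp := (volume_preserving_finTwoArrow ℝ).symm
  have hemb := (MeasurableEquiv.finTwoArrow (α := ℝ)).symm.measurableEmbedding
  have hpre : (MeasurableEquiv.finTwoArrow (α := ℝ)).symm ⁻¹' {x : Fin 2 → ℝ | x 1 ∈ s}
      = univ ×ˢ s := by
    ext z
    simp [MeasurableEquiv.finTwoArrow]
  rw [← hmp.setIntegral_preimage_emb hemb, hpre, Measure.volume_eq_prod, setIntegral_prod]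
  · simp [MeasurableEquiv.finTwoArrow]
  · exact ((hmp.integrable_comp_emb hemb).2 hF).integrableOn

lemma setIntegral_preimage_coord_one' {F : (Fin 2 → ℝ) → ℝ} (hF : Integrable F) {s : Set ℝ} :
    ∫ x in {x : Fin 2 → ℝ | x 1 ∈ s}, F x = ∫ b in s, ∫ a : ℝ, F ![a, b] := by
  have hmp := (volume_preserving_finTwoArrow ℝ).symm
  have hemb := (MeasurableEquiv.finTwoArrow (α := ℝ)).symm.measurableEmbedding
  have hi := (hmp.integrable_comp_emb hemb).2 hF
  rw [setIntegral_preimage_coord_one hF]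
  refine integral_integral_swap ?_
  rw [Measure.volume_eq_prod] at hi
  have := hi.integrableOn (s := univ ×ˢ s)
  rw [IntegrableOn, ← Measure.prod_restrict, Measure.restrict_univ] at this
  simpa [Function.comp_def, Function.uncurry_def, MeasurableEquiv.finTwoArrow] using this

lemma integrable_fderiv_apply {E : Type*} [NormedAddCommGroup E] [NormedSpace ℝ E]
    [MeasurableSpace E] [BorelSpace E] {μ : Measure E} [IsFiniteMeasureOnCompacts μ]
    {g : E → ℝ} (hg : ContDiff ℝ 1 g) (h2g : HasCompactSupport g) (v : E) :
    Integrable (fun x => fderiv ℝ g x v) μ :=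
  ((hg.continuous_fderiv one_ne_zero).clm_apply continuous_const).integrable_of_hasCompactSupport
    (h2g.fderiv_apply ℝ v)

lemma add_smul_single_zero (a b : ℝ) :
    (![0, b] + a • Pi.single 0 1 : Fin 2 → ℝ) = ![a, b] := by
  ext i; fin_cases i <;> simp

lemma add_smul_single_one (a b : ℝ) :
    (![a, 0] + b • Pi.single 1 1 : Fin 2 → ℝ) = ![a, b] := by
  ext i; fin_cases i <;> simp

lemma setIntegral_fderiv_coord_zero (hg : ContDiff ℝ 1 g) (h2g : HasCompactSupport g)
    (s : Set ℝ) :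
    ∫ x in {x : Fin 2 → ℝ | x 1 ∈ s}, fderiv ℝ g x (Pi.single 0 1) = 0 := by
  rw [setIntegral_preimage_coord_one' (integrable_fderiv_apply hg h2g _)]
  have h b := integral_fderiv_line hg h2g ![0, b] (v := Pi.single 0 1) (by simp)
  simp only [add_smul_single_zero] at h
  simp [h]

lemma integral_fderiv_coord (hg : ContDiff ℝ 1 g) (h2g : HasCompactSupport g) (i : Fin 2) :
    ∫ x : Fin 2 → ℝ, fderiv ℝ g x (Pi.single i 1) = 0 := by
  fin_cases i
  · simpa using setIntegral_fderiv_coord_zero hg h2g univ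
  · have := setIntegral_preimage_coord_one
      (integrable_fderiv_apply (μ := volume) hg h2g (Pi.single 1 1)) univ
    have h a := integral_fderiv_line hg h2g ![a, 0] (v := Pi.single 1 1) (by simp)
    simp only [add_smul_single_one] at h
    simpa [h] using this

lemma setIntegral_fderiv_coord_one (hg : ContDiff ℝ 1 g) (h2g : HasCompactSupport g) :
    ∫ x in {x : Fin 2 → ℝ | x 1 ∈ Iio (0 : ℝ)}, fderiv ℝ g x (Pi.single 1 1)
      = ∫ a : ℝ, g ![a, 0] := by
  rw [setIntegral_preimage_coord_one (integrable_fderiv_apply hg h2g _)]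
  have h a := integral_fderiv_line_Iio hg h2g ![a, 0] (v := Pi.single 1 1) (by simp)
  simp only [add_smul_single_one] at h
  simp [h]

end PlaneIntegrals

section TestFunctions

variable {φ : SpaceTime → ℝ}

lemma IsTest.contDiff_one (hφ : IsTest φ) : ContDiff ℝ 1 φ :=
  hφ.1.of_le (by exact_mod_cast le_top)

lemma IsTest.integrable_pdt (hφ : IsTest φ) : Integrable (pdt φ) := by
  rw [Measure.volume_eq_prod]
  exact integrable_fderiv_apply hφ.contDiff_one hφ.2 _

lemma IsTest.integrable_pdx (hφ : IsTest φ) (i : Fin 2) : Integrable (pdx i φ) := by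
  rw [Measure.volume_eq_prod]
  exact integrable_fderiv_apply hφ.contDiff_one hφ.2 _

lemma IsTest.slice_contDiff (hφ : IsTest φ) (t : ℝ) :
    ContDiff ℝ 1 fun x : Fin 2 → ℝ => φ (x, t) :=
  hφ.contDiff_one.comp (by fun_prop)

lemma IsTest.slice_hasCompactSupport (hφ : IsTest φ) (t : ℝ) :
    HasCompactSupport fun x : Fin 2 → ℝ => φ (x, t) :=
  hφ.2.comp_isClosedEmbedding (IsClosedEmbedding.of_continuous_injective_isClosedMap
    (by fun_prop) (fun _ _ h => congrArg Prod.fst h) (isClosedMap_prodMk_right t))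

lemma IsTest.integrable_slice (hφ : IsTest φ) (t : ℝ) :
    Integrable fun x : Fin 2 → ℝ => φ (x, t) :=
  (hφ.slice_contDiff t).continuous.integrable_of_hasCompactSupport (hφ.slice_hasCompactSupport t)

lemma IsTest.pdx_eq_fderiv_slice (hφ : IsTest φ) (i : Fin 2) (x : Fin 2 → ℝ) (t : ℝ) :
    pdx i φ (x, t) = fderiv ℝ (fun y : Fin 2 → ℝ => φ (y, t)) x (Pi.single i 1) := by
  have h1 : HasFDerivAt (fun y : Fin 2 → ℝ => ((y, t) : SpaceTime))
      (ContinuousLinearMap.inl ℝ (Fin 2 → ℝ) ℝ) x := hasFDerivAt_prodMk_left x t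
  have h2 := ((hφ.contDiff_one.differentiable one_ne_zero (x, t)).hasFDerivAt.comp x h1).fderiv
  simp only [Function.comp_def] at h2
  rw [h2]
  simp [pdx]

lemma IsTest.setIntegral_pdt (hφ : IsTest φ) (D : Set (Fin 2 → ℝ)) :
    ∫ q in D ×ˢ Ioi (0 : ℝ), pdt φ q = - ∫ x in D, φ (x, 0) := by
  have hi := hφ.integrable_pdt
  rw [Measure.volume_eq_prod] at hi ⊢
  rw [setIntegral_prod _ hi.integrableOn, ← integral_neg]
  congr 1 with x
  have := integral_fderiv_line_Ioi hφ.contDiff_one hφ.2 (x, 0) (v := (0, 1)) (by simp)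
  simpa [pdt] using this

lemma IsTest.setIntegral_pdx (hφ : IsTest φ) (i : Fin 2) (D : Set (Fin 2 → ℝ)) :
    ∫ q in D ×ˢ Ioi (0 : ℝ), pdx i φ q
      = ∫ t in Ioi (0 : ℝ), ∫ x in D,
          fderiv ℝ (fun y : Fin 2 → ℝ => φ (y, t)) x (Pi.single i 1) := by
  have hi := (hφ.integrable_pdx i)
  rw [Measure.volume_eq_prod] at hi ⊢
  have hs : Integrable (fun z : ℝ × (Fin 2 → ℝ) => pdx i φ z.swap) (volume.prod volume) := hi.swap
  rw [← setIntegral_prod_swap, setIntegral_prod _ hs.integrableOn]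
  simp [hφ.pdx_eq_fderiv_slice]

/-- The integral of `φ` over the interface `{x₂ = νt, t > 0}`. -/
def interfaceIntegral (ν : ℝ) (φ : SpaceTime → ℝ) : ℝ :=
  ∫ t in Ioi (0 : ℝ), ∫ a : ℝ, φ (![a, ν * t], t)

lemma interfaceIntegral_nonneg (ν : ℝ) (h : ∀ q, 0 ≤ φ q) : 0 ≤ interfaceIntegral ν φ :=
  integral_nonneg fun _ => integral_nonneg fun _ => h _

lemma posTime_eq : posTime = (univ : Set (Fin 2 → ℝ)) ×ˢ Ioi (0 : ℝ) := by
  ext q; simp [posTime]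

lemma IsTest.integral_posTime (hφ : IsTest φ) (A : ℝ) (c : Fin 2 → ℝ) :
    ∫ q in posTime, (A * pdt φ q + ∑ i, c i * pdx i φ q) = - A * ∫ x, φ (x, 0) := by
  rw [posTime_eq, integral_add (hφ.integrable_pdt.integrableOn.const_mul _)
    (integrable_finsetSum _ fun i _ => (hφ.integrable_pdx i).integrableOn.const_mul _),
    integral_finsetSum _ fun i _ => (hφ.integrable_pdx i).integrableOn.const_mul _]
  simp_rw [integral_const_mul, hφ.setIntegral_pdt, hφ.setIntegral_pdx, Measure.restrict_univ,
    integral_fderiv_coord (hφ.slice_contDiff _) (hφ.slice_hasCompactSupport _)]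
  simp

/-- The shear `(x, t) ↦ (x + νt e₂, t)`. -/
def shear (ν : ℝ) : SpaceTime ≃ₜ SpaceTime where
  toFun q := (q.1 + (ν * q.2) • Pi.single 1 1, q.2)
  invFun q := (q.1 - (ν * q.2) • Pi.single 1 1, q.2)
  left_inv q := by simp
  right_inv q := by simp
  continuous_toFun := by fun_prop
  continuous_invFun := by fun_prop

lemma shear_apply (ν : ℝ) (q : SpaceTime) :
    shear ν q = (q.1 + (ν * q.2) • Pi.single 1 1, q.2) := rfl

lemma measurePreserving_shear (ν : ℝ) :
    MeasurePreserving (shear ν) (volume : Measure SpaceTime) volume := by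
  have h := MeasurePreserving.skew_product (μa := (volume : Measure ℝ))
    (μc := (volume : Measure (Fin 2 → ℝ))) (μd := (volume : Measure (Fin 2 → ℝ)))
    (MeasurePreserving.id _)
    (g := fun t x => x + (ν * t) • (Pi.single 1 1 : Fin 2 → ℝ))
    (by fun_prop) (Eventually.of_forall fun t => map_add_right_eq_self _ _)
  exact (Measure.measurePreserving_swap.comp h).comp Measure.measurePreserving_swap

lemma IsTest.comp_shear (hφ : IsTest φ) (ν : ℝ) : IsTest (φ ∘ shear ν) := by
  refine ⟨hφ.1.comp ?_, hφ.2.comp_homeomorph _⟩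
  change ContDiff ℝ _ fun q : SpaceTime => (q.1 + (ν * q.2) • Pi.single 1 1, q.2)
  fun_prop

/-- The shear as a continuous linear map. -/
def shearL (ν : ℝ) : SpaceTime →L[ℝ] SpaceTime :=
  (ContinuousLinearMap.fst ℝ _ _ + (ν • ContinuousLinearMap.snd ℝ (Fin 2 → ℝ) ℝ).smulRight
    (Pi.single 1 1)).prod (ContinuousLinearMap.snd ℝ _ _)

lemma coe_shearL (ν : ℝ) : ⇑(shearL ν) = shear ν := by
  ext q <;> simp [shearL, shear_apply]

lemma IsTest.fderiv_comp_shear (hφ : IsTest φ) (ν : ℝ) (q v : SpaceTime) :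
    fderiv ℝ (φ ∘ shear ν) q v = fderiv ℝ φ (shear ν q) (shear ν v) := by
  rw [← coe_shearL, fderiv_comp _ (hφ.contDiff_one.differentiable one_ne_zero _)
    (shearL ν).differentiableAt, (shearL ν).fderiv]
  rfl

lemma IsTest.pdt_comp_shear (hφ : IsTest φ) (ν : ℝ) (q : SpaceTime) :
    pdt φ (shear ν q) = pdt (φ ∘ shear ν) q - ν * pdx 1 (φ ∘ shear ν) q := by
  simp only [pdt, pdx, hφ.fderiv_comp_shear, ← smul_eq_mul, ← map_smul, ← map_sub]
  simp [shear_apply]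

lemma IsTest.pdx_comp_shear (hφ : IsTest φ) (ν : ℝ) (i : Fin 2) (q : SpaceTime) :
    pdx i φ (shear ν q) = pdx i (φ ∘ shear ν) q := by
  simp [pdx, hφ.fderiv_comp_shear, shear_apply]

/-- The part of `{t > 0}` lying below the interface `{x₂ = νt}`. -/
def belowInterface (ν : ℝ) : Set SpaceTime := {q | q.1 1 < ν * q.2} ∩ posTime

lemma shear_preimage_belowInterface (ν : ℝ) :
    shear ν ⁻¹' belowInterface ν = {x : Fin 2 → ℝ | x 1 ∈ Iio (0 : ℝ)} ×ˢ Ioi (0 : ℝ) := by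
  ext q; simp [shear_apply, belowInterface, posTime]

lemma IsTest.integral_belowInterface (hφ : IsTest φ) (ν A : ℝ) (c : Fin 2 → ℝ) :
    ∫ q in belowInterface ν, (A * pdt φ q + ∑ i, c i * pdx i φ q)
      = (c 1 - ν * A) * interfaceIntegral ν φ
        - A * ∫ x in {x : Fin 2 → ℝ | x 1 ∈ Iio (0 : ℝ)}, φ (x, 0) := by
  have hψ := hφ.comp_shear ν
  rw [← (measurePreserving_shear ν).setIntegral_preimage_emb (shear ν).measurableEmbedding,
    shear_preimage_belowInterface]
  have h1 : ∀ q, A * pdt φ (shear ν q) + ∑ i, c i * pdx i φ (shear ν q)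
      = A * pdt (φ ∘ shear ν) q + (c 0 * pdx 0 (φ ∘ shear ν) q
        + (c 1 - ν * A) * pdx 1 (φ ∘ shear ν) q) := by
    intro q
    rw [hφ.pdt_comp_shear, Fin.sum_univ_two, hφ.pdx_comp_shear, hφ.pdx_comp_shear]
    ring
  simp_rw [h1]
  rw [integral_add (hψ.integrable_pdt.integrableOn.const_mul _)
    (((hψ.integrable_pdx 0).integrableOn.const_mul _).fun_add
      ((hψ.integrable_pdx 1).integrableOn.const_mul _)),
    integral_add ((hψ.integrable_pdx 0).integrableOn.const_mul _)
      ((hψ.integrable_pdx 1).integrableOn.const_mul _)]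
  simp_rw [integral_const_mul, hψ.setIntegral_pdt, hψ.setIntegral_pdx,
    setIntegral_fderiv_coord_zero (hψ.slice_contDiff _) (hψ.slice_hasCompactSupport _),
    setIntegral_fderiv_coord_one (hψ.slice_contDiff _) (hψ.slice_hasCompactSupport _)]
  have h2 : ∀ a t : ℝ, (![a, 0] + (ν * t) • Pi.single 1 1 : Fin 2 → ℝ) = ![a, ν * t] :=
    fun a t => add_smul_single_one a (ν * t)
  simp only [interfaceIntegral, Function.comp, shear_apply, h2, mul_zero, zero_smul, add_zero,
    integral_zero, zero_add]
  ring

end TestFunctions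

section FanIntegrals

variable {φ : SpaceTime → ℝ} {νm ν1 νp : ℝ}

lemma measurableSet_lowerHalfPlane : MeasurableSet {x : Fin 2 → ℝ | x 1 ∈ Iio (0 : ℝ)} :=
  (measurable_pi_apply 1) measurableSet_Iio

lemma measurableSet_belowLine (ν : ℝ) : MeasurableSet {q : SpaceTime | q.1 1 < ν * q.2} :=
  (isOpen_lt (by fun_prop) (by fun_prop)).measurableSet

lemma fanField_eq_sum_indicator (h1 : νm < ν1) (h2 : ν1 < νp) (a b c d : ℝ) {q : SpaceTime}
    (hq : 0 < q.2) :
    fanField νm ν1 νp a b c d q = d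
      + {q : SpaceTime | q.1 1 < νm * q.2}.indicator (fun _ => a - b) q
      + {q : SpaceTime | q.1 1 < ν1 * q.2}.indicator (fun _ => b - c) q
      + {q : SpaceTime | q.1 1 < νp * q.2}.indicator (fun _ => c - d) q := by
  have h1' := mul_lt_mul_of_pos_right h1 hq
  have h2' := mul_lt_mul_of_pos_right h2 hq
  simp only [fanField, indicator_apply, mem_ofPred_eq]
  split_ifs <;> first | (exfalso; linarith) | ring

lemma IsTest.integrable_combination (hφ : IsTest φ) (A : ℝ) (c : Fin 2 → ℝ) :
    Integrable fun q => A * pdt φ q + ∑ i, c i * pdx i φ q :=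
  (hφ.integrable_pdt.const_mul _).add
    (integrable_finsetSum _ fun i _ => (hφ.integrable_pdx i).const_mul _)

lemma IsTest.integral_indicator_riemann (hφ : IsTest φ) (a d : ℝ) :
    ∫ x : Fin 2 → ℝ, (if x 1 < 0 then a else d) * φ (x, 0)
      = d * (∫ x, φ (x, 0))
        + (a - d) * ∫ x in {x : Fin 2 → ℝ | x 1 ∈ Iio (0 : ℝ)}, φ (x, 0) := by
  have hm := measurableSet_lowerHalfPlane
  rw [← integral_const_mul, ← integral_const_mul, ← integral_indicator hm,
    ← integral_add ((hφ.integrable_slice 0).const_mul _)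
      (((hφ.integrable_slice 0).const_mul _).indicator hm)]
  congr 1 with x
  simp only [indicator_apply, mem_ofPred_eq, mem_Iio]
  split_ifs <;> ring

/-- Rankine–Hugoniot formula: the weak form of `∂_t a + div_x c` for piecewise constant fields on
a fan partition reduces to the jumps across the three interfaces. -/
lemma IsTest.integral_fanField (hφ : IsTest φ) (h1 : νm < ν1) (h2 : ν1 < νp)
    (am a1 a2 ap : ℝ) (cm c1 c2 cp : Fin 2 → ℝ) :
    (∫ q in posTime, (fanField νm ν1 νp am a1 a2 ap q * pdt φ q
        + ∑ i, fanField νm ν1 νp (cm i) (c1 i) (c2 i) (cp i) q * pdx i φ q))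
      + (∫ x : Fin 2 → ℝ, (if x 1 < 0 then am else ap) * φ (x, 0))
    = (cm 1 - c1 1 - νm * (am - a1)) * interfaceIntegral νm φ
      + (c1 1 - c2 1 - ν1 * (a1 - a2)) * interfaceIntegral ν1 φ
      + (c2 1 - cp 1 - νp * (a2 - ap)) * interfaceIntegral νp φ := by
  have hpos : MeasurableSet posTime := (isOpen_lt (by fun_prop) (by fun_prop)).measurableSet
  have hsplit : ∀ q ∈ posTime, fanField νm ν1 νp am a1 a2 ap q * pdt φ q
        + ∑ i, fanField νm ν1 νp (cm i) (c1 i) (c2 i) (cp i) q * pdx i φ q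
      = (ap * pdt φ q + ∑ i, cp i * pdx i φ q)
        + {q : SpaceTime | q.1 1 < νm * q.2}.indicator
          (fun q => (am - a1) * pdt φ q + ∑ i, (cm - c1) i * pdx i φ q) q
        + {q : SpaceTime | q.1 1 < ν1 * q.2}.indicator
          (fun q => (a1 - a2) * pdt φ q + ∑ i, (c1 - c2) i * pdx i φ q) q
        + {q : SpaceTime | q.1 1 < νp * q.2}.indicator
          (fun q => (a2 - ap) * pdt φ q + ∑ i, (c2 - cp) i * pdx i φ q) q := by
    intro q hq
    simp only [fanField_eq_sum_indicator h1 h2 _ _ _ _ hq, Fin.sum_univ_two, indicator_apply,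
      Pi.sub_apply]
    split_ifs <;> ring
  have hint : ∀ (ν A : ℝ) (c : Fin 2 → ℝ), IntegrableOn ({q : SpaceTime | q.1 1 < ν * q.2}.indicator
      (fun q => A * pdt φ q + ∑ i, c i * pdx i φ q)) posTime := fun ν A c =>
    ((hφ.integrable_combination A c).indicator (measurableSet_belowLine ν)).integrableOn
  have hval : ∀ (ν A : ℝ) (c : Fin 2 → ℝ), ∫ q in posTime, {q : SpaceTime | q.1 1 < ν * q.2}.indicator
      (fun q => A * pdt φ q + ∑ i, c i * pdx i φ q) q
      = (c 1 - ν * A) * interfaceIntegral ν φ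
        - A * ∫ x in {x : Fin 2 → ℝ | x 1 ∈ Iio (0 : ℝ)}, φ (x, 0) := fun ν A c => by
    rw [integral_indicator (measurableSet_belowLine ν),
      Measure.restrict_restrict (measurableSet_belowLine ν)]
    exact hφ.integral_belowInterface ν A c
  have h0 := (hφ.integrable_combination ap cp).integrableOn (s := posTime)
  rw [setIntegral_congr_fun hpos hsplit,
    integral_add ((h0.fun_add (hint _ _ _)).fun_add (hint _ _ _)) (hint _ _ _),
    integral_add (h0.fun_add (hint _ _ _)) (hint _ _ _), integral_add h0 (hint _ _ _),
    hval, hval, hval, hφ.integral_posTime, hφ.integral_indicator_riemann]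
  simp only [Pi.sub_apply]
  ring

end FanIntegrals

section InternalEnergy

variable {γ : ℝ}

lemma pressure_lt_pressure (hγ : 1 ≤ γ) {r s : ℝ} (hr : 0 < r) (hrs : r < s) :
    pressure γ r < pressure γ s :=
  Real.rpow_lt_rpow hr.le hrs (by linarith)

lemma hasDerivAt_pressure {r : ℝ} (hr : 0 < r) :
    HasDerivAt (pressure γ) (γ * r ^ (γ - 1)) r :=
  Real.hasDerivAt_rpow_const (Or.inl hr.ne')

lemma hasDerivAt_intEnergy {r : ℝ} (hr : 0 < r) :
    HasDerivAt (intEnergy γ) (pressure γ r / r ^ 2) r := by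
  unfold intEnergy pressure
  by_cases h : γ = 1
  · simp only [h, if_true]
    convert! Real.hasDerivAt_log hr.ne' using 1
    rw [Real.rpow_one]
    field_simp
  · simp only [h, if_false]
    have h1 : γ - 1 ≠ 0 := sub_ne_zero.2 h
    convert! (Real.hasDerivAt_rpow_const (p := γ - 1) (Or.inl hr.ne')).div_const (γ - 1) using 1
    rw [mul_div_cancel_left₀ _ h1, ← Real.rpow_natCast, ← Real.rpow_sub hr]
    congr 1
    push_cast
    ring

lemma pressure_sub_lt (hγ : 1 ≤ γ) {r s : ℝ} (hr : 0 < r) (hrs : r < s) :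
    r * (pressure γ s - pressure γ r) < γ * pressure γ s * (s - r) := by
  have hs : 0 < s := hr.trans hrs
  have hp : 0 < pressure γ s := Real.rpow_pos_of_pos hs γ
  have h := one_add_mul_self_le_rpow_one_add (s := r / s - 1) (by linarith [div_pos hr hs]) hγ
  have h1 : pressure γ r = pressure γ s * (1 + (r / s - 1)) ^ γ := by
    rw [add_sub_cancel, Real.div_rpow hr.le hs.le, pressure, pressure,
      mul_div_cancel₀ _ (Real.rpow_pos_of_pos hs γ).ne']
  have h2 : pressure γ s * (1 + γ * (r / s - 1)) ≤ pressure γ r := by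
    rw [h1]
    gcongr
  have h3 : pressure γ s - pressure γ r ≤ γ * pressure γ s * (s - r) / s := by
    have : γ * pressure γ s * (s - r) / s
        = pressure γ s - pressure γ s * (1 + γ * (r / s - 1)) := by
      field_simp
      ring
    linarith
  have h4 : 0 < γ * pressure γ s * (s - r) := by
    have : 0 < s - r := sub_pos.2 hrs
    positivity
  calc r * (pressure γ s - pressure γ r) ≤ r * (γ * pressure γ s * (s - r) / s) := by gcongr
    _ = (r / s) * (γ * pressure γ s * (s - r)) := by ring
    _ < 1 * (γ * pressure γ s * (s - r)) := by
        gcongr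
        exact (div_lt_one hs).2 hrs
    _ = _ := one_mul _

/-- The specific volume dissipation rate `(p(r) + p(s))/2 · (1/r - 1/s) - (ε(s) - ε(r))` of a shock
compressing the gas from density `r` to density `s`. -/
def shockDissipation (γ r s : ℝ) : ℝ :=
  (pressure γ r + pressure γ s) / 2 * (1 / r - 1 / s) - (intEnergy γ s - intEnergy γ r)

lemma shockDissipation_pos (hγ : 1 ≤ γ) {r s : ℝ} (hr : 0 < r) (hrs : r < s) :
    0 < shockDissipation γ r s := by
  have hd : ∀ x, 0 < x → HasDerivAt (shockDissipation γ r)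
      ((γ * x ^ (γ - 1)) / 2 * (1 / r - 1 / x) + (pressure γ r + pressure γ x) / 2 * (1 / x ^ 2)
        - pressure γ x / x ^ 2) x := by
    intro x hx
    have hinv : HasDerivAt (fun y : ℝ => 1 / r - 1 / y) (1 / x ^ 2) x := by
      simpa [one_div] using (hasDerivAt_inv hx.ne').const_sub (1 / r)
    exact ((((hasDerivAt_pressure hx).const_add _).div_const 2).mul hinv).sub
      ((hasDerivAt_intEnergy hx).sub_const _)
  have hmono : StrictMonoOn (shockDissipation γ r) (Ici r) := by
    refine strictMonoOn_of_deriv_pos (convex_Ici r)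
      (fun x hx => (hd x (hr.trans_le hx)).continuousAt.continuousWithinAt) fun x hx => ?_
    rw [interior_Ici, mem_Ioi] at hx
    have hx0 := hr.trans hx
    rw [(hd x hx0).deriv, Real.rpow_sub_one hx0.ne']
    have h := pressure_sub_lt hγ hr hx
    change 0 < γ * (pressure γ x / x) / 2 * (1 / r - 1 / x)
      + (pressure γ r + pressure γ x) / 2 * (1 / x ^ 2) - pressure γ x / x ^ 2
    have : γ * (pressure γ x / x) / 2 * (1 / r - 1 / x)
      + (pressure γ r + pressure γ x) / 2 * (1 / x ^ 2) - pressure γ x / x ^ 2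
      = (γ * pressure γ x * (x - r) - r * (pressure γ x - pressure γ r)) / (2 * r * x ^ 2) := by
      field_simp
      ring
    rw [this]
    exact div_pos (sub_pos.2 h) (by positivity)
  have h0 : shockDissipation γ r r = 0 := by simp [shockDissipation]
  rw [← h0]
  exact hmono self_mem_Ici hrs.le hrs

end InternalEnergy

section Shocks

variable {γ : ℝ}

/-- Jump of the normal velocity across a shock joining the density `r` at rest pressure to a state
with density `z.1` and normal momentum flux `z.2`. -/
def velocityJump (γ r : ℝ) (z : ℝ × ℝ) : ℝ :=
  √((1 / r - 1 / z.1) * (z.2 - pressure γ r))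

/-- Mass flux through the shock with velocity jump `velocityJump γ r z`. -/
def massFlux (γ r : ℝ) (z : ℝ × ℝ) : ℝ := (z.2 - pressure γ r) / velocityJump γ r z

/-- Energy balance of the shock entering with normal velocity `V`, where the middle state
`(density, normal momentum flux) = z` carries the tangential excess `δ`. -/
def energyBalance (γ r V δ : ℝ) (z : ℝ × ℝ) : ℝ :=
  massFlux γ r z * (intEnergy γ z.1 - intEnergy γ r + ((V - velocityJump γ r z) ^ 2 - V ^ 2) / 2
      + ((z.2 - pressure γ z.1) / z.1 + δ) / 2)
    + pressure γ z.1 * (V - velocityJump γ r z) - pressure γ r * V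

lemma one_div_sub_pos {r s : ℝ} (hr : 0 < r) (hrs : r < s) : 0 < 1 / r - 1 / s :=
  sub_pos.2 (one_div_lt_one_div_of_lt hr hrs)

lemma velocityJump_pos {r : ℝ} {z : ℝ × ℝ} (hr : 0 < r) (h1 : r < z.1)
    (h2 : pressure γ r < z.2) : 0 < velocityJump γ r z :=
  Real.sqrt_pos.2 (mul_pos (one_div_sub_pos hr h1) (sub_pos.2 h2))

lemma massFlux_pos {r : ℝ} {z : ℝ × ℝ} (hr : 0 < r) (h1 : r < z.1)
    (h2 : pressure γ r < z.2) : 0 < massFlux γ r z :=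
  div_pos (sub_pos.2 h2) (velocityJump_pos hr h1 h2)

lemma massFlux_mul_velocityJump {r : ℝ} {z : ℝ × ℝ} (hr : 0 < r) (h1 : r < z.1)
    (h2 : pressure γ r < z.2) : massFlux γ r z * velocityJump γ r z = z.2 - pressure γ r :=
  div_mul_cancel₀ _ (velocityJump_pos hr h1 h2).ne'

lemma massFlux_mul_sub {r : ℝ} {z : ℝ × ℝ} (hr : 0 < r) (h1 : r < z.1)
    (h2 : pressure γ r < z.2) :
    massFlux γ r z * (1 / r - 1 / z.1) = velocityJump γ r z := by
  have hJ := velocityJump_pos hr h1 h2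
  have hsq : velocityJump γ r z ^ 2 = (1 / r - 1 / z.1) * (z.2 - pressure γ r) :=
    Real.sq_sqrt (mul_pos (one_div_sub_pos hr h1) (sub_pos.2 h2)).le
  rw [massFlux, div_mul_eq_mul_div, div_eq_iff hJ.ne', ← sq, hsq, mul_comm]

lemma continuousAt_velocityJump (r : ℝ) {z : ℝ × ℝ} (hz : 0 < z.1) :
    ContinuousAt (velocityJump γ r) z := by
  unfold velocityJump
  have : z.1 ≠ 0 := hz.ne'
  fun_prop (disch := assumption)

lemma velocityJump_lt_snd {r ρ P Q : ℝ} (hr : 0 < r) (h1 : r < ρ) (h2 : pressure γ r < P)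
    (hPQ : P < Q) : velocityJump γ r (ρ, P) < velocityJump γ r (ρ, Q) := by
  have h3 := one_div_sub_pos hr h1
  have h4 : 0 < P - pressure γ r := sub_pos.2 h2
  refine Real.sqrt_lt_sqrt (by positivity) ?_
  dsimp only
  gcongr

lemma velocityJump_lt_fst {r ρ σ P : ℝ} (hr : 0 < r) (h1 : r < ρ) (h2 : pressure γ r < P)
    (hρσ : ρ < σ) : velocityJump γ r (ρ, P) < velocityJump γ r (σ, P) := by
  have h3 := one_div_sub_pos hr h1
  have h4 : 0 < P - pressure γ r := sub_pos.2 h2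
  have h5 := one_div_lt_one_div_of_lt (hr.trans h1) hρσ
  refine Real.sqrt_lt_sqrt (by positivity) ?_
  dsimp only
  gcongr

lemma energyBalance_eq {r ρ : ℝ} (V δ : ℝ) (hγ : 1 ≤ γ) (hr : 0 < r) (h : r < ρ) :
    energyBalance γ r V δ (ρ, pressure γ ρ)
      = massFlux γ r (ρ, pressure γ ρ) * (δ / 2 - shockDissipation γ r ρ) := by
  have hp := pressure_lt_pressure hγ hr h
  have e1 := massFlux_mul_velocityJump (γ := γ) (z := (ρ, pressure γ ρ)) hr h hp
  have e2 := massFlux_mul_sub (γ := γ) (z := (ρ, pressure γ ρ)) hr h hp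
  simp only [energyBalance, shockDissipation, sub_self, zero_div] at e1 e2 ⊢
  linear_combination (velocityJump γ r (ρ, pressure γ ρ) / 2 - V) * e1
    + (pressure γ r + pressure γ ρ) / 2 * e2

lemma eventually_energyBalance_neg {r ρ : ℝ} (V : ℝ) {δ : ℝ} (hγ : 1 ≤ γ) (hr : 0 < r)
    (h : r < ρ) (hδ : δ ≤ shockDissipation γ r ρ) :
    ∀ᶠ z in 𝓝 (ρ, pressure γ ρ), energyBalance γ r V δ z < 0 := by
  have hρ : 0 < ρ := hr.trans h
  have hp := pressure_lt_pressure hγ hr h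
  have hneg : energyBalance γ r V δ (ρ, pressure γ ρ) < 0 := by
    rw [energyBalance_eq V δ hγ hr h]
    have h1 := shockDissipation_pos hγ hr h
    exact mul_neg_of_pos_of_neg (massFlux_pos hr h hp) (by linarith)
  refine ContinuousAt.eventually_lt ?_ continuousAt_const hneg
  have hJ : ContinuousAt (velocityJump γ r) (ρ, pressure γ ρ) := continuousAt_velocityJump r hρ
  have hJ0 : velocityJump γ r (ρ, pressure γ ρ) ≠ 0 := (velocityJump_pos hr h hp).ne'
  have hP : ContinuousAt (fun z : ℝ × ℝ => pressure γ z.1) (ρ, pressure γ ρ) :=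
    ContinuousAt.comp (g := pressure γ) (f := Prod.fst) (hasDerivAt_pressure hρ).continuousAt
      continuousAt_fst
  have hE : ContinuousAt (fun z : ℝ × ℝ => intEnergy γ z.1) (ρ, pressure γ ρ) :=
    ContinuousAt.comp (g := intEnergy γ) (f := Prod.fst) (hasDerivAt_intEnergy hρ).continuousAt
      continuousAt_fst
  have hM : ContinuousAt (massFlux γ r) (ρ, pressure γ ρ) :=
    (continuousAt_snd.sub continuousAt_const).div hJ hJ0
  have hQ : ContinuousAt (fun z : ℝ × ℝ => (z.2 - pressure γ z.1) / z.1) (ρ, pressure γ ρ) :=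
    (continuousAt_snd.sub hP).div continuousAt_fst hρ.ne'
  unfold energyBalance
  fun_prop

lemma tendsto_velocityJump_atTop (hγ : 1 ≤ γ) {r : ℝ} (hr : 0 < r) :
    Tendsto (fun ρ => velocityJump γ r (ρ, pressure γ ρ)) atTop atTop := by
  refine Real.tendsto_sqrt_atTop.comp (Tendsto.pos_mul_atTop (C := 1 / r) (by positivity) ?_ ?_)
  · simpa [one_div] using (tendsto_inv_atTop_zero (𝕜 := ℝ)).const_sub (1 / r)
  · exact tendsto_atTop_add_const_right _ _ (tendsto_rpow_atTop (by linarith))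

lemma velocityJump_self (γ r P : ℝ) : velocityJump γ r (r, P) = 0 := by
  simp [velocityJump]

lemma velocityJump_pressure {r s : ℝ} (hr : 0 < r) (hs : 0 < s) :
    velocityJump γ r (s, pressure γ s)
      = √((s - r) * (pressure γ s - pressure γ r) / (s * r)) := by
  simp only [velocityJump]
  congr 1
  field_simp

/-- The two-shock Riemann problem: the velocity jumps add up to any prescribed value above the
threshold, for some intermediate density exceeding both outer ones. -/
lemma exists_two_shock_density (hγ : 1 ≤ γ) {ρm ρp Δ : ℝ} (hρm : 0 < ρm) (hρp : 0 < ρp)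
    (h : √((ρp - ρm) * (pressure γ ρp - pressure γ ρm) / (ρp * ρm)) < Δ) :
    ∃ ρ, ρm < ρ ∧ ρp < ρ ∧
      velocityJump γ ρm (ρ, pressure γ ρ) + velocityJump γ ρp (ρ, pressure γ ρ) = Δ := by
  set K : ℝ → ℝ := fun ρ =>
    velocityJump γ ρm (ρ, pressure γ ρ) + velocityJump γ ρp (ρ, pressure γ ρ) with hK
  have hK0 : K (max ρm ρp) < Δ := by
    rcases le_total ρm ρp with hle | hle
    · rw [max_eq_right hle]
      simpa only [hK, velocityJump_self, add_zero, velocityJump_pressure hρm hρp] using h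
    · rw [max_eq_left hle]
      simp only [hK, velocityJump_self, zero_add, velocityJump_pressure hρp hρm]
      convert h using 2
      ring
  obtain ⟨R, hR1, hR2⟩ := ((tendsto_velocityJump_atTop hγ hρm).eventually_gt_atTop Δ |>.and
    (eventually_ge_atTop (max ρm ρp))).exists
  have hR : Δ < K R := hR1.trans_le (le_add_of_nonneg_right (Real.sqrt_nonneg _))
  have hcont : ContinuousOn K (Icc (max ρm ρp) R) := by
    intro x hx
    have hx0 : 0 < x := (lt_max_of_lt_left hρm).trans_le hx.1
    have hp : ContinuousAt (fun ρ => (ρ, pressure γ ρ)) x :=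
      continuousAt_id.prodMk (hasDerivAt_pressure hx0).continuousAt
    have hj : ∀ r, ContinuousAt (fun ρ => velocityJump γ r (ρ, pressure γ ρ)) x := fun r =>
      ContinuousAt.comp (f := fun ρ => (ρ, pressure γ ρ)) (continuousAt_velocityJump r hx0) hp
    exact ((hj ρm).add (hj ρp)).continuousWithinAt
  obtain ⟨ρ, hρ, hρK⟩ := intermediate_value_Ioo hR2 hcont ⟨hK0, hR⟩
  exact ⟨ρ, (le_max_left _ _).trans_lt hρ.1, (le_max_right _ _).trans_lt hρ.1, hρK⟩

/-- The two-shock state can be perturbed so that the normal momentum flux strictly exceeds the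
pressure of the middle state. -/
lemma exists_perturbed_two_shock (hγ : 1 ≤ γ) {ρm ρp ρ₀ Δ : ℝ} (hρm : 0 < ρm) (hρp : 0 < ρp)
    (hm : ρm < ρ₀) (hp : ρp < ρ₀)
    (hΔ : velocityJump γ ρm (ρ₀, pressure γ ρ₀) + velocityJump γ ρp (ρ₀, pressure γ ρ₀) = Δ)
    {Q : ℝ × ℝ → Prop} (hQ : ∀ᶠ z in 𝓝 (ρ₀, pressure γ ρ₀), Q z) :
    ∃ ρ P, ρm < ρ ∧ ρp < ρ ∧ pressure γ ρ < P ∧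
      velocityJump γ ρm (ρ, P) + velocityJump γ ρp (ρ, P) = Δ ∧ Q (ρ, P) := by
  set P₀ := pressure γ ρ₀ with hP₀
  have hPm : pressure γ ρm < P₀ := pressure_lt_pressure hγ hρm hm
  have hPp : pressure γ ρp < P₀ := pressure_lt_pressure hγ hρp hp
  obtain ⟨η, hη, hball⟩ := Metric.eventually_nhds_iff.1 hQ
  set P₁ := P₀ + η / 2 with hP₁
  have hP01 : P₀ < P₁ := by linarith
  have hlarge : Δ < velocityJump γ ρm (ρ₀, P₁) + velocityJump γ ρp (ρ₀, P₁) := by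
    rw [← hΔ]
    exact add_lt_add (velocityJump_lt_snd hρm hm hPm hP01) (velocityJump_lt_snd hρp hp hPp hP01)
  have hρ₀ : 0 < ρ₀ := hρm.trans hm
  have hj : ∀ r, ContinuousAt (fun ρ => velocityJump γ r (ρ, P₁)) ρ₀ := fun r =>
    ContinuousAt.comp (f := fun ρ => (ρ, P₁)) (continuousAt_velocityJump r hρ₀) (by fun_prop)
  have hev : ∀ᶠ ρ in 𝓝[<] ρ₀, (Δ < velocityJump γ ρm (ρ, P₁) + velocityJump γ ρp (ρ, P₁) ∧
      ρm < ρ ∧ ρp < ρ ∧ ρ₀ - η < ρ) ∧ ρ < ρ₀ :=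
    (((continuousAt_const.eventually_lt ((hj ρm).add (hj ρp)) hlarge).and
      ((eventually_gt_nhds hm).and ((eventually_gt_nhds hp).and
        (eventually_gt_nhds (by linarith))))).filter_mono nhdsWithin_le_nhds).and
      self_mem_nhdsWithin
  obtain ⟨ρ, ⟨h1, hρm', hρp', hρη⟩, hρlt⟩ := hev.exists
  have hρ : 0 < ρ := hρm.trans hρm'
  have hsmall : velocityJump γ ρm (ρ, P₀) + velocityJump γ ρp (ρ, P₀) < Δ := by
    rw [← hΔ]
    exact add_lt_add (velocityJump_lt_fst hρm hρm' hPm hρlt)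
      (velocityJump_lt_fst hρp hρp' hPp hρlt)
  have hcont : ContinuousOn
      (fun P => velocityJump γ ρm (ρ, P) + velocityJump γ ρp (ρ, P)) (Icc P₀ P₁) := by
    unfold velocityJump
    dsimp only
    fun_prop
  obtain ⟨P, hP, hPeq⟩ := intermediate_value_Ioo hP01.le hcont ⟨hsmall, h1⟩
  refine ⟨ρ, P, hρm', hρp', (pressure_lt_pressure hγ hρ hρlt).trans hP.1, hPeq, hball ?_⟩
  rw [Prod.dist_eq, Real.dist_eq, Real.dist_eq]
  exact max_lt (abs_lt.2 ⟨by linarith, by linarith⟩)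
    (abs_lt.2 ⟨by linarith [hP.1], by linarith [hP.2]⟩)

end Shocks

section FanSubsolutions

variable {γ : ℝ} {φ : SpaceTime → ℝ}

/-- The left state and the shock speed belonging to `velocityJump` satisfy the Rankine–Hugoniot
conditions. -/
lemma massFlux_identities {r V ν : ℝ} {z : ℝ × ℝ} (hr : 0 < r) (h1 : r < z.1)
    (h2 : pressure γ r < z.2) (hν : ν = V - velocityJump γ r z - massFlux γ r z / z.1) :
    r * (V - ν) = massFlux γ r z ∧ z.1 * (V - velocityJump γ r z - ν) = massFlux γ r z := by
  have hz : z.1 ≠ 0 := (hr.trans h1).ne'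
  have e := massFlux_mul_sub hr h1 h2
  have e1 : z.1 * (V - velocityJump γ r z - ν) = massFlux γ r z := by
    rw [hν]
    field_simp
    ring
  refine ⟨?_, e1⟩
  rw [hν, ← e]
  field_simp
  ring

/-- The trace-free matrix of a middle state with velocity `v` and tangential excess `δ`. -/
def fanMatrix (v : Fin 2 → ℝ) (δ C : ℝ) : Matrix (Fin 2) (Fin 2) ℝ :=
  !![v 0 ^ 2 + δ - C / 2, v 0 * v 1; v 0 * v 1, -(v 0 ^ 2 + δ - C / 2)]

lemma isS0_fanMatrix (v : Fin 2 → ℝ) (δ C : ℝ) : IsS0 (fanMatrix v δ C) := by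
  constructor
  · ext i j
    fin_cases i <;> fin_cases j <;> simp [fanMatrix]
  · simp [fanMatrix, Matrix.trace_fin_two]

lemma posDef_fanMatrix (v : Fin 2 → ℝ) {δ κ : ℝ} (hδ : 0 < δ) (hκ : 0 < κ) :
    (((v 0 ^ 2 + v 1 ^ 2 + κ + δ) / 2) • (1 : Matrix (Fin 2) (Fin 2) ℝ) - outer v
      + fanMatrix v δ (v 0 ^ 2 + v 1 ^ 2 + κ + δ)).PosDef := by
  have h : ((v 0 ^ 2 + v 1 ^ 2 + κ + δ) / 2) • (1 : Matrix (Fin 2) (Fin 2) ℝ) - outer v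
      + fanMatrix v δ (v 0 ^ 2 + v 1 ^ 2 + κ + δ) = Matrix.diagonal ![δ, κ] := by
    ext i j
    fin_cases i <;> fin_cases j <;> simp [fanMatrix, outer, vecMulVec_apply] <;> ring
  rw [h]
  refine Matrix.PosDef.diagonal fun i => ?_
  fin_cases i <;> simpa

/-- The weak continuity equation follows from the Rankine–Hugoniot conditions. -/
lemma IsTest.fanField_weak_eq_zero {νm ν1 νp : ℝ} (hφ : IsTest φ) (h1 : νm < ν1) (h2 : ν1 < νp)
    (am a1 a2 ap : ℝ) (cm c1 c2 cp : Fin 2 → ℝ) (em : cm 1 - c1 1 - νm * (am - a1) = 0)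
    (e1 : c1 1 - c2 1 - ν1 * (a1 - a2) = 0) (ep : c2 1 - cp 1 - νp * (a2 - ap) = 0) :
    (∫ q in posTime, (fanField νm ν1 νp am a1 a2 ap q * pdt φ q
        + ∑ i, fanField νm ν1 νp (cm i) (c1 i) (c2 i) (cp i) q * pdx i φ q))
      + (∫ x : Fin 2 → ℝ, (if x 1 < 0 then am else ap) * φ (x, 0)) = 0 := by
  rw [hφ.integral_fanField h1 h2, em, e1, ep]
  ring

lemma IsTest.fanField_weak_nonneg {νm ν1 νp : ℝ} (hφ : IsTest φ) (h0 : ∀ q, 0 ≤ φ q)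
    (hs : tsupport φ ⊆ posTime) (h1 : νm < ν1) (h2 : ν1 < νp)
    (am a1 a2 ap : ℝ) (cm c1 c2 cp : Fin 2 → ℝ) (em : 0 ≤ cm 1 - c1 1 - νm * (am - a1))
    (e1 : 0 ≤ c1 1 - c2 1 - ν1 * (a1 - a2)) (ep : 0 ≤ c2 1 - cp 1 - νp * (a2 - ap)) :
    0 ≤ ∫ q in posTime, (fanField νm ν1 νp am a1 a2 ap q * pdt φ q
        + ∑ i, fanField νm ν1 νp (cm i) (c1 i) (c2 i) (cp i) q * pdx i φ q) := by
  have h := hφ.integral_fanField h1 h2 am a1 a2 ap cm c1 c2 cp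
  have hz : ∀ x : Fin 2 → ℝ, φ (x, 0) = 0 := fun x =>
    image_eq_zero_of_notMem_tsupport fun hx => lt_irrefl (0 : ℝ) (hs hx)
  simp only [hz, mul_zero, integral_zero, add_zero] at h
  rw [h]
  have := interfaceIntegral_nonneg νm h0
  have := interfaceIntegral_nonneg ν1 h0
  have := interfaceIntegral_nonneg νp h0
  positivity

lemma sum_fanField_add_ite (νm ν1 νp : ℝ) (am a1 a2 ap : Fin 2 → ℝ) (bm b1 b2 bp : ℝ) (j : Fin 2)
    (X : Fin 2 → ℝ) (q : SpaceTime) :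
    ∑ i, fanField νm ν1 νp (am i + if i = j then bm else 0) (a1 i + if i = j then b1 else 0)
        (a2 i + if i = j then b2 else 0) (ap i + if i = j then bp else 0) q * X i
      = ∑ i, fanField νm ν1 νp (am i) (a1 i) (a2 i) (ap i) q * X i
        + fanField νm ν1 νp bm b1 b2 bp q * X j := by
  unfold fanField
  by_cases h1 : q.1 1 < νm * q.2
  · simp [h1, add_mul, Finset.sum_add_distrib]
  by_cases h2 : q.1 1 < ν1 * q.2
  · simp [h1, h2, add_mul, Finset.sum_add_distrib]
  by_cases h3 : q.1 1 < νp * q.2 <;> simp [h1, h2, h3, add_mul, Finset.sum_add_distrib]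

/-- The fan subsolution built from two shocks with common middle density `ρ`, normal momentum flux
`P` and tangential excess `δ`. -/
lemma isAdmissibleFanSubsolution_two_shocks {ρm ρp ρ P δ β νm νp : ℝ} (hρm : 0 < ρm)
    (hρp : 0 < ρp) (vm vp : Fin 2 → ℝ) (hm : ρm < ρ) (hp : ρp < ρ) (hPm : pressure γ ρm < P)
    (hPp : pressure γ ρp < P) (hP : pressure γ ρ < P) (hδ : 0 < δ)
    (hβm : β = vm 1 - velocityJump γ ρm (ρ, P)) (hβp : β = vp 1 + velocityJump γ ρp (ρ, P))
    (hνm : νm = β - massFlux γ ρm (ρ, P) / ρ) (hνp : νp = β + massFlux γ ρp (ρ, P) / ρ)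
    (hEm : energyBalance γ ρm (vm 1) δ (ρ, P) ≤ 0)
    (hEp : energyBalance γ ρp (-vp 1) δ (ρ, P) ≤ 0) {C1 C2 : ℝ}
    (hC1 : C1 = vm 0 ^ 2 + β ^ 2 + (P - pressure γ ρ) / ρ + δ)
    (hC2 : C2 = vp 0 ^ 2 + β ^ 2 + (P - pressure γ ρ) / ρ + δ) :
    IsAdmissibleFanSubsolution (pressure γ) (intEnergy γ) ρm ρp vm vp νm β νp ρ ρ
      ![vm 0, β] ![vp 0, β] (fanMatrix ![vm 0, β] δ C1) (fanMatrix ![vp 0, β] δ C2) C1 C2 := by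
  have hρ : 0 < ρ := hρm.trans hm
  have hM := massFlux_pos (z := (ρ, P)) hρm hm hPm
  have hN := massFlux_pos (z := (ρ, P)) hρp hp hPp
  have hMJ := massFlux_mul_velocityJump (z := (ρ, P)) hρm hm hPm
  have hNJ := massFlux_mul_velocityJump (z := (ρ, P)) hρp hp hPp
  obtain ⟨hM1, hM2⟩ := massFlux_identities (z := (ρ, P)) (V := vm 1) (ν := νm) hρm hm hPm
    (by rw [hνm, hβm])
  obtain ⟨hN1, hN2⟩ := massFlux_identities (z := (ρ, P)) (V := -vp 1) (ν := -νp) hρp hp hPp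
    (by rw [hνp, hβp]; ring)
  have hκ : 0 < (P - pressure γ ρ) / ρ := div_pos (sub_pos.2 hP) hρ
  have hκρ : ρ * ((P - pressure γ ρ) / ρ) = P - pressure γ ρ := mul_div_cancel₀ _ hρ.ne'
  unfold energyBalance at hEm hEp
  dsimp only at hMJ hNJ hM2 hN2 hEm hEp
  have hJm : velocityJump γ ρm (ρ, P) = vm 1 - β := by linarith
  have hJp : velocityJump γ ρp (ρ, P) = β - vp 1 := by linarith
  rw [hJm] at hMJ hM2 hEm
  rw [hJp] at hNJ hN2 hEp
  have hνm' : νm < β := by rw [hνm]; exact sub_lt_self _ (div_pos hM hρ)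
  have hνp' : β < νp := by rw [hνp]; exact lt_add_of_pos_right _ (div_pos hN hρ)
  generalize massFlux γ ρm (ρ, P) = M at *
  generalize massFlux γ ρp (ρ, P) = N at *
  generalize (P - pressure γ ρ) / ρ = κ at *
  refine ⟨⟨hνm', hνp', hρ, hρ, isS0_fanMatrix _ _ _, isS0_fanMatrix _ _ _, by rw [hC1]; positivity,
    by rw [hC2]; positivity, ?_, ?_, fun φ hφ => ?_, fun j φ hφ => ?_⟩, fun φ hφ h0 hs => ?_⟩
  · rw [hC1]
    exact posDef_fanMatrix ![vm 0, β] hδ hκ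
  · rw [hC2]
    exact posDef_fanMatrix ![vp 0, β] hδ hκ
  · refine hφ.fanField_weak_eq_zero hνm' hνp' _ _ _ _ (fun i => ρm * vm i)
      (fun i => ρ * ![vm 0, β] i) (fun i => ρ * ![vp 0, β] i) (fun i => ρp * vp i) ?_ ?_ ?_
    · simp
      linear_combination hM1 - hM2
    · simp
    · simp
      linear_combination hN1 - hN2
  · have h := hφ.fanField_weak_eq_zero hνm' hνp' (ρm * vm j) (ρ * ![vm 0, β] j)
      (ρ * ![vp 0, β] j) (ρp * vp j)
      (fun i => ρm * uPM vm j i + if i = j then pressure γ ρm + ρm * sq2 vm / 2 else 0)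
      (fun i => ρ * fanMatrix ![vm 0, β] δ C1 j i
        + if i = j then pressure γ ρ + C1 * ρ / 2 else 0)
      (fun i => ρ * fanMatrix ![vp 0, β] δ C2 j i
        + if i = j then pressure γ ρ + C2 * ρ / 2 else 0)
      (fun i => ρp * uPM vp j i + if i = j then pressure γ ρp + ρp * sq2 vp / 2 else 0)
      (by
        fin_cases j
        · simp [uPM, outer, vecMulVec_apply, fanMatrix]
          linear_combination vm 0 * (hM1 - hM2)
        · simp [uPM, outer, vecMulVec_apply, fanMatrix, sq2, Fin.sum_univ_two]
          rw [hC1]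
          linear_combination vm 1 * hM1 - β * hM2 + hMJ - hκρ)
      (by
        fin_cases j
        · simp [fanMatrix]
          ring
        · simp [fanMatrix]
          rw [hC1, hC2]
          ring)
      (by
        fin_cases j
        · simp [uPM, outer, vecMulVec_apply, fanMatrix]
          linear_combination vp 0 * (hN1 - hN2)
        · simp [uPM, outer, vecMulVec_apply, fanMatrix, sq2, Fin.sum_univ_two]
          rw [hC2]
          linear_combination vp 1 * hN1 - β * hN2 - hNJ + hκρ)
    refine Eq.trans (congrArg₂ (· + ·) ?_ ?_) h
    · congr 1
      funext q
      rw [add_assoc, ← sum_fanField_add_ite]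
    · congr 1
      funext x
      simp only [riemannRho, riemannV]
      split_ifs <;> rfl
  · have h := hφ.fanField_weak_nonneg h0 hs hνm' hνp'
      (ρm * intEnergy γ ρm + ρm * sq2 vm / 2) (ρ * intEnergy γ ρ + ρ * C1 / 2)
      (ρ * intEnergy γ ρ + ρ * C2 / 2) (ρp * intEnergy γ ρp + ρp * sq2 vp / 2)
      (fun i => (ρm * intEnergy γ ρm + ρm * sq2 vm / 2 + pressure γ ρm) * vm i)
      (fun i => (ρ * intEnergy γ ρ + ρ * C1 / 2 + pressure γ ρ) * ![vm 0, β] i)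
      (fun i => (ρ * intEnergy γ ρ + ρ * C2 / 2 + pressure γ ρ) * ![vp 0, β] i)
      (fun i => (ρp * intEnergy γ ρp + ρp * sq2 vp / 2 + pressure γ ρp) * vp i)
      (by
        simp [sq2, Fin.sum_univ_two]
        rw [hC1]
        linear_combination hEm
          + (intEnergy γ ρ + (vm 0 ^ 2 + β ^ 2 + κ + δ) / 2) * hM2
          - (intEnergy γ ρm + (vm 0 ^ 2 + vm 1 ^ 2) / 2) * hM1)
      (by
        simp
        apply le_of_eq
        ring)
      (by
        simp [sq2, Fin.sum_univ_two]
        rw [hC2]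
        linear_combination hEp
          + (intEnergy γ ρ + (vp 0 ^ 2 + β ^ 2 + κ + δ) / 2) * hN2
          - (intEnergy γ ρp + (vp 0 ^ 2 + vp 1 ^ 2) / 2) * hN1)
    refine h.trans_eq ?_
    congr 1
    funext q
    simp only [fanEnergy, fanField]
    split_ifs <;> rfl

end FanSubsolutions

/-- Under the assumptions of Theorem 1 there exists an admissible fan subsolution, which
can moreover be chosen to satisfy the ansatz `α₁ = v₋₁`, `α₂ = v₊₁`, `ρ₁ = ρ₂`,
`β₁ = β₂ = ν₁` and `C₁ − v₋₁² = C₂ − v₊₁²`. -/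
theorem exists_admissible_fan_subsolution_two_shocks
    (γ : ℝ) (hγ : 1 ≤ γ) (ρm ρp : ℝ) (hρm : 0 < ρm) (hρp : 0 < ρp) (vm vp : Fin 2 → ℝ)
    (h : vm 1 - vp 1 >
      Real.sqrt ((ρp - ρm) * (pressure γ ρp - pressure γ ρm) / (ρp * ρm))) :
    ∃ (νm ν1 νp ρ1 ρ2 : ℝ) (v1 v2 : Fin 2 → ℝ) (u1 u2 : Matrix (Fin 2) (Fin 2) ℝ)
      (C1 C2 : ℝ),
      IsAdmissibleFanSubsolution (pressure γ) (intEnergy γ) ρm ρp vm vp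
        νm ν1 νp ρ1 ρ2 v1 v2 u1 u2 C1 C2 ∧
      v1 0 = vm 0 ∧ v2 0 = vp 0 ∧ ρ1 = ρ2 ∧ v1 1 = v2 1 ∧ v1 1 = ν1 ∧
      C1 - vm 0 ^ 2 = C2 - vp 0 ^ 2 := by
  obtain ⟨ρ₀, hm₀, hp₀, hJ₀⟩ := exists_two_shock_density hγ hρm hρp h
  set δ := min (shockDissipation γ ρm ρ₀) (shockDissipation γ ρp ρ₀) with hδ
  have hδ0 : 0 < δ :=
    lt_min (shockDissipation_pos hγ hρm hm₀) (shockDissipation_pos hγ hρp hp₀)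
  obtain ⟨ρ, P, hm, hp, hP, hJ, hEm, hEp⟩ := exists_perturbed_two_shock hγ hρm hρp hm₀ hp₀ hJ₀
    ((eventually_energyBalance_neg (vm 1) hγ hρm hm₀ (min_le_left _ _)).and
      (eventually_energyBalance_neg (-vp 1) hγ hρp hp₀ (min_le_right _ _)))
  refine ⟨_, _, _, ρ, ρ, _, _, _, _, _, _, isAdmissibleFanSubsolution_two_shocks hρm hρp vm vp hm hp
    ((pressure_lt_pressure hγ hρm hm).trans hP) ((pressure_lt_pressure hγ hρp hp).trans hP) hP hδ0
    rfl (by linarith) rfl rfl hEm.le hEp.le rfl rfl, rfl, rfl, rfl, rfl, rfl, by ring⟩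

end
end

section
/- Let C₁, C₂ > 0, v₋₁, v₊₁, β, γ₁, γ₂ ∈ ℝ with γ₁ − C₁/2 = γ₂ − C₂/2, and define ε₁ = C₁/2 − γ₁ − β², ε₂ = C₁ − v₋₁² − β² − ε₁, ε₂′ = C₂ − v₊₁² − β² − ε₁. Then the four subsolution conditions v₋₁² + β² < C₁, v₊₁² + β² < C₂, (C₁/2 − v₋₁² + γ₁)(C₁/2 − β² − γ₁) > 0, and (C₂/2 − v₊₁² + γ₂)(C₁/2 − β² − γ₁) > 0 hold if and only if ε₁ > 0, ε₂ > 0 and ε₂′ > 0. -/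
/-- With `γ₁ − C₁/2 = γ₂ − C₂/2`, `ε₁ = C₁/2 − γ₁ − β²`, `ε₂ = C₁ − v₋₁² − β² − ε₁` and
`ε₂' = C₂ − v₊₁² − β² − ε₁`, the four subsolution conditions are equivalent to
`ε₁ > 0`, `ε₂ > 0` and `ε₂' > 0`. -/
theorem subsolution_conditions_iff
    (C1 C2 vm1 vp1 β γ1 γ2 ε1 ε2 ε2' : ℝ) (hC1 : 0 < C1) (hC2 : 0 < C2)
    (hγ12 : γ1 - C1 / 2 = γ2 - C2 / 2)
    (hε1 : ε1 = C1 / 2 - γ1 - β ^ 2)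
    (hε2 : ε2 = C1 - vm1 ^ 2 - β ^ 2 - ε1)
    (hε2' : ε2' = C2 - vp1 ^ 2 - β ^ 2 - ε1) :
    (vm1 ^ 2 + β ^ 2 < C1 ∧ vp1 ^ 2 + β ^ 2 < C2 ∧
     (C1 / 2 - vm1 ^ 2 + γ1) * (C1 / 2 - β ^ 2 - γ1) > 0 ∧
     (C2 / 2 - vp1 ^ 2 + γ2) * (C1 / 2 - β ^ 2 - γ1) > 0)
    ↔ (0 < ε1 ∧ 0 < ε2 ∧ 0 < ε2') := by
  have h1 : C1 / 2 - β ^ 2 - γ1 = ε1 := by linarith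
  have h2 : C1 / 2 - vm1 ^ 2 + γ1 = ε2 := by linarith
  have h3 : C2 / 2 - vp1 ^ 2 + γ2 = ε2' := by linarith
  rw [h1, h2, h3]
  constructor
  · rintro ⟨hm, -, hprod, hprod'⟩
    have hpos : 0 < ε1 := by
      rcases mul_pos_iff.mp hprod with h | h
      · exact h.2
      · linarith [h.1, h.2]
    exact ⟨hpos, pos_of_mul_pos_left hprod hpos.le, pos_of_mul_pos_left hprod' hpos.le⟩
  · rintro ⟨h, h', h''⟩
    exact ⟨by linarith, by linarith, mul_pos h' h, mul_pos h'' h⟩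
end

section
/- Let p(ρ) = ρ^γ with γ ≥ 1 and let ε be the internal energy with p(r) = r²ε′(r). Let ρ₋, ρ₁ > 0 with ρ₋ ≠ ρ₁, let v₋₁, v₋₂, β, ν₋, γ₁, C₁ ∈ ℝ, set ε₁ = C₁/2 − γ₁ − β² and ε₂ = C₁ − v₋₁² − β² − ε₁, and assume the left-interface jump conditions ν₋(ρ₋ − ρ₁) = ρ₋v₋₂ − ρ₁β and ν₋(ρ₋v₋₂ − ρ₁β) = ρ₋v₋₂² − ρ₁(β² + ε₁) + p(ρ₋) − p(ρ₁). Then the left-interface admissibility inequality ν₋(ρ₋ε(ρ₋) − ρ₁ε(ρ₁)) + ν₋(ρ₋(v₋₁² + v₋₂²)/2 − ρ₁C₁/2) ≤ [(ρ₋ε(ρ₋)+p(ρ₋))v₋₂ − (ρ₁ε(ρ₁)+p(ρ₁))β] + (ρ₋v₋₂(v₋₁² + v₋₂²)/2 − ρ₁βC₁/2) is equivalent to the inequality (β − v₋₂)(p(ρ₋) + p(ρ₁) − 2ρ₋ρ₁(ε(ρ₋) − ε(ρ₁))/(ρ₋ − ρ₁)) ≤ ε₁ρ₁(v₋₂ +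 β) − (ε₁ + ε₂)ρ₋ρ₁(β − v₋₂)/(ρ₋ − ρ₁). -/
open MeasureTheory

noncomputable section

/-- Equivalence of the left-interface admissibility inequality with its reduced form in the
variables `ε₁, ε₂`, given the left-interface Rankine–Hugoniot conditions. -/
theorem left_admissibility_iff
    (γ : ℝ) (hγ : 1 ≤ γ) (ρm ρ1 : ℝ) (hρm : 0 < ρm) (hρ1 : 0 < ρ1) (hne : ρm ≠ ρ1)
    (vm1 vm2 β νm γ1 C1 ε1 ε2 : ℝ)
    (hε1 : ε1 = C1 / 2 - γ1 - β ^ 2) (hε2 : ε2 = C1 - vm1 ^ 2 - β ^ 2 - ε1)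
    (h1 : νm * (ρm - ρ1) = ρm * vm2 - ρ1 * β)
    (h2 : νm * (ρm * vm2 - ρ1 * β) =
      ρm * vm2 ^ 2 - ρ1 * (β ^ 2 + ε1) + pressure γ ρm - pressure γ ρ1) :
    (νm * (ρm * intEnergy γ ρm - ρ1 * intEnergy γ ρ1)
        + νm * (ρm * (vm1 ^ 2 + vm2 ^ 2) / 2 - ρ1 * C1 / 2)
      ≤ ((ρm * intEnergy γ ρm + pressure γ ρm) * vm2
          - (ρ1 * intEnergy γ ρ1 + pressure γ ρ1) * β)
        + (ρm * vm2 * (vm1 ^ 2 + vm2 ^ 2) / 2 - ρ1 * β * C1 / 2))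
    ↔ ((β - vm2) * (pressure γ ρm + pressure γ ρ1
          - 2 * ρm * ρ1 * (intEnergy γ ρm - intEnergy γ ρ1) / (ρm - ρ1))
        ≤ ε1 * ρ1 * (vm2 + β) - (ε1 + ε2) * (ρm * ρ1 * (β - vm2) / (ρm - ρ1))) := by
  have hd : ρm - ρ1 ≠ 0 := sub_ne_zero.mpr hne
  have hν : νm = (ρm * vm2 - ρ1 * β) / (ρm - ρ1) := by rw [eq_div_iff hd, h1]
  have hP : pressure γ ρm = pressure γ ρ1 + ρ1 * ε1
      + ρm * ρ1 * (β - vm2) ^ 2 / (ρm - ρ1) := by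
    rw [hν] at h2
    field_simp at h2 ⊢
    linear_combination -h2
  have hε : ε1 + ε2 = C1 - vm1 ^ 2 - β ^ 2 := by rw [hε2]; ring
  generalize pressure γ ρm = P at *
  generalize pressure γ ρ1 = Q at *
  generalize intEnergy γ ρm = E at *
  generalize intEnergy γ ρ1 = F at *
  -- The defect of the reduced inequality is twice that of the admissibility inequality.
  have key : (β - vm2) * (P + Q - 2 * ρm * ρ1 * (E - F) / (ρm - ρ1))
        - (ε1 * ρ1 * (vm2 + β) - (ε1 + ε2) * (ρm * ρ1 * (β - vm2) / (ρm - ρ1)))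
      = 2 * ((νm * (ρm * E - ρ1 * F)
          + νm * (ρm * (vm1 ^ 2 + vm2 ^ 2) / 2 - ρ1 * C1 / 2))
        - (((ρm * E + P) * vm2 - (ρ1 * F + Q) * β)
          + (ρm * vm2 * (vm1 ^ 2 + vm2 ^ 2) / 2 - ρ1 * β * C1 / 2))) := by
    rw [hε, hν, hP]
    field_simp
    ring
  constructor <;> intro h <;> linarith

end
end
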